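/- arXiv:2603.27814 — 5 statements merged into one kernel-verified Lean document; each statement's English description precedes it below -/
import Mathlib

section
/- Let E be a real Hilbert space, f : E → ℝ differentiable with gradient ∇f, and 0 < μ ≤ L. Assume f is μ-strongly convex and L-smooth, and let x* satisfy ∇f x* = 0. Then for the gradient-descent step with step size α = 2/(μ+L), every x ∈ E satisfies ‖(x − α ∇f x) − x*‖ ≤ ((L − μ)/(L + μ)) · ‖x − x*‖. -/
open scoped RealInnerProductSpace

/-- The descent lemma. -/
lemma descent_aux
    {E : Type*} [NormedAddCommGroup E] [InnerProductSpace ℝ E] [CompleteSpace E]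
    (f : E → ℝ) (gradf : E → E) (L : ℝ)
    (hdiff : ∀ x, HasGradientAt f (gradf x) x)
    (hsmooth : ∀ x y, ‖gradf x - gradf y‖ ≤ L * ‖x - y‖) (x v : E) :
    f (x + v) ≤ f x + ⟪gradf x, v⟫ + (L / 2) * ‖v‖ ^ 2 := by
  have hline : ∀ t : ℝ, HasDerivAt (fun s : ℝ => x + s • v) v t := by
    intro t
    simpa using ((hasDerivAt_id t).smul_const v).const_add x
  have hf : ∀ t : ℝ, HasDerivAt (fun s : ℝ => f (x + s • v)) ⟪gradf (x + t • v), v⟫ t := by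
    intro t
    have h := (hdiff (x + t • v)).hasFDerivAt.comp_hasDerivAt t (hline t)
    simpa [Function.comp_def] using h
  have hφ : ∀ t : ℝ, HasDerivAt
      (fun s : ℝ => f (x + s • v) - s * ⟪gradf x, v⟫ - (L / 2 * ‖v‖ ^ 2) * s ^ 2)
      (⟪gradf (x + t • v), v⟫ - ⟪gradf x, v⟫ - (L / 2 * ‖v‖ ^ 2) * (2 * t)) t := by
    intro t
    have h1 := (hasDerivAt_id t).mul_const ⟪gradf x, v⟫
    have h2 := ((hasDerivAt_id t).pow 2).const_mul (L / 2 * ‖v‖ ^ 2)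
    have h3 := ((hf t).sub h1).sub h2
    refine HasDerivAt.congr_deriv h3 ?_
    simp
  have hanti : AntitoneOn
      (fun s : ℝ => f (x + s • v) - s * ⟪gradf x, v⟫ - (L / 2 * ‖v‖ ^ 2) * s ^ 2)
      (Set.Ici 0) := by
    apply antitoneOn_of_deriv_nonpos (convex_Ici 0)
    · exact fun t _ => (hφ t).continuousAt.continuousWithinAt
    · exact fun t _ => (hφ t).differentiableAt.differentiableWithinAt
    · intro t ht
      rw [(hφ t).deriv, ← inner_sub_left]
      have ht' : 0 < t := by simpa using ht
      have h1 := real_inner_le_norm (gradf (x + t • v) - gradf x) v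
      have h2 := hsmooth (x + t • v) x
      rw [add_sub_cancel_left, norm_smul, Real.norm_of_nonneg ht'.le] at h2
      have h3 := mul_le_mul_of_nonneg_right h2 (norm_nonneg v)
      nlinarith
  have h := hanti (Set.mem_Ici.2 le_rfl) (Set.mem_Ici.2 zero_le_one) zero_le_one
  simp at h
  linarith

theorem quad_aux (M P Q : ℝ) (hM : 0 ≤ M) (hP : 0 ≤ P)
    (h : ∀ t : ℝ, 0 ≤ M * (t ^ 2 * P) - 2 * (t * P) + Q) : P ≤ M * Q := by
  rcases hM.eq_or_lt with h0 | h0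
  · subst h0
    rcases hP.eq_or_lt with h1 | h1
    · simp [← h1]
    · have h2 := h ((Q + 1) / (2 * P))
      have h3 : (Q + 1) / (2 * P) * P = (Q + 1) / 2 := by field_simp
      rw [h3] at h2
      linarith
  · have h2 := mul_nonneg h0.le (h (1 / M))
    have h3 : M * (M * ((1 / M) ^ 2 * P) - 2 * ((1 / M) * P) + Q) = -P + M * Q := by
      field_simp
      ring
    linarith

/-- Single-step contraction of gradient descent with step size `2/(μ+L)` for a
`μ`-strongly convex, `L`-smooth function on a real Hilbert space. -/
theorem gd_step_contraction
    {E : Type*} [NormedAddCommGroup E] [InnerProductSpace ℝ E] [CompleteSpace E]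
    (f : E → ℝ) (gradf : E → E) (μ L : ℝ) (hμ : 0 < μ) (hμL : μ ≤ L)
    (hdiff : ∀ x, HasGradientAt f (gradf x) x)
    (hsc : ∀ x y, f y ≥ f x + ⟪gradf x, y - x⟫ + (μ / 2) * ‖y - x‖ ^ 2)
    (hsmooth : ∀ x y, ‖gradf x - gradf y‖ ≤ L * ‖x - y‖)
    (xstar : E) (hstar : gradf xstar = 0) (x : E) :
    ‖(x - (2 / (μ + L)) • gradf x) - xstar‖ ≤ ((L - μ) / (L + μ)) * ‖x - xstar‖ := by
  obtain ⟨e, rfl⟩ : ∃ e, x = xstar + e := ⟨x - xstar, by abel⟩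
  set g := gradf (xstar + e) with hg
  have key : ∀ w : E, 0 ≤ 2 * ⟪g, w⟫ + ⟪g, e⟫ + L * ‖w‖ ^ 2 - μ * ‖e + w‖ ^ 2 := by
    intro w
    have a1 := hsc xstar (xstar + e + w)
    have a2 := descent_aux f gradf L hdiff hsmooth (xstar + e) w
    have b1 := hsc (xstar + e) (xstar + -w)
    have b2 := descent_aux f gradf L hdiff hsmooth xstar (-w)
    have e1 : xstar + e + w - xstar = e + w := by abel
    have e2 : xstar + -w - (xstar + e) = -(e + w) := by abel
    rw [e1, hstar, inner_zero_left] at a1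
    rw [e2, norm_neg, inner_neg_right, inner_add_right, ← hg] at b1
    rw [hstar, inner_zero_left, norm_neg] at b2
    rw [← hg] at a2
    linarith
  have hco : ‖g‖ ^ 2 + μ * L * ‖e‖ ^ 2 ≤ (L + μ) * ⟪g, e⟫ := by
    have hP : ‖g - μ • e‖ ^ 2 = ‖g‖ ^ 2 - 2 * μ * ⟪g, e⟫ + μ ^ 2 * ‖e‖ ^ 2 := by
      rw [norm_sub_sq_real, inner_smul_right, norm_smul, mul_pow, Real.norm_eq_abs, sq_abs]
      ring
    have := quad_aux (L - μ) (‖g - μ • e‖ ^ 2) (⟪g, e⟫ - μ * ‖e‖ ^ 2) (by linarith)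
      (by positivity) (by
        intro t
        have h := key (-(t • (g - μ • e)))
        have c1 : ‖t • (g - μ • e)‖ ^ 2 = t ^ 2 * ‖g - μ • e‖ ^ 2 := by
          rw [norm_smul, mul_pow, Real.norm_eq_abs, sq_abs]
        rw [norm_add_sq_real, norm_neg, c1, inner_neg_right, inner_neg_right, inner_smul_right,
          inner_smul_right, inner_sub_right, inner_sub_right, inner_smul_right, inner_smul_right,
          real_inner_self_eq_norm_sq, real_inner_self_eq_norm_sq, real_inner_comm g e, hP] at h
        rw [hP]
        linarith)
    rw [hP] at this
    linarith
  have hs : 0 < L + μ := by linarith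
  have e3 : xstar + e - (2 / (μ + L)) • g - xstar = e - (2 / (μ + L)) • g := by abel
  have e4 : xstar + e - xstar = e := by abel
  rw [e3, e4]
  refine (sq_le_sq₀ (norm_nonneg _)
    (mul_nonneg (div_nonneg (by linarith) hs.le) (norm_nonneg e))).1 ?_
  rw [norm_sub_sq_real, inner_smul_right, norm_smul, mul_pow, mul_pow, Real.norm_eq_abs, sq_abs,
    real_inner_comm, add_comm μ L]
  have h5 : ((L - μ) / (L + μ)) ^ 2 * ‖e‖ ^ 2
      - (‖e‖ ^ 2 - 2 * (2 / (L + μ) * ⟪g, e⟫) + (2 / (L + μ)) ^ 2 * ‖g‖ ^ 2)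
      = 4 / (L + μ) ^ 2 * ((L + μ) * ⟪g, e⟫ - (‖g‖ ^ 2 + μ * L * ‖e‖ ^ 2)) := by
    field_simp
    ring
  have h6 : 0 ≤ 4 / (L + μ) ^ 2 * ((L + μ) * ⟪g, e⟫ - (‖g‖ ^ 2 + μ * L * ‖e‖ ^ 2)) :=
    mul_nonneg (by positivity) (by linarith)
  linarith
end

section
/- Let E be a real Hilbert space, n a positive natural number, z : Fin n → E with ‖z i‖ ≤ C for all i (C ≥ 0), and B ≥ 0. Then the average over all sign vectors σ : Fin n → ({−1, 1} ⊆ ℝ) of sup { (1/n) · ∑_i σ i · ⟪w, z i⟫ | w ∈ E, ‖w‖ ≤ B } is at most B · C / √n. -/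
open scoped RealInnerProductSpace

/-- Sign flip on `{-1, 1}`. -/
def signFlip : Equiv.Perm ({-1, 1} : Finset ℝ) :=
  Function.Involutive.toPerm
    (fun s => ⟨-(s : ℝ), by
      have h := s.2
      simp only [Finset.mem_insert, Finset.mem_singleton] at h ⊢
      rcases h with h | h <;> rw [h] <;> norm_num⟩)
    (fun s => by ext; simp)

lemma signFlip_coe (s : ({-1, 1} : Finset ℝ)) : ((signFlip s : ({-1, 1} : Finset ℝ)) : ℝ) = -s := rfl

lemma pmSign_mul_self (s : ({-1, 1} : Finset ℝ)) : (s : ℝ) * s = 1 := by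
  have h := s.2
  simp only [Finset.mem_insert, Finset.mem_singleton] at h
  rcases h with h | h <;> rw [h] <;> norm_num

lemma card_signs (n : ℕ) : Fintype.card (Fin n → ({-1, 1} : Finset ℝ)) = 2 ^ n := by
  rw [Fintype.card_fun, Fintype.card_coe, Finset.card_pair (by norm_num), Fintype.card_fin]

lemma sum_signs (n : ℕ) (i j : Fin n) :
    ∑ σ : Fin n → ({-1, 1} : Finset ℝ), (σ i : ℝ) * (σ j : ℝ) = if i = j then 2 ^ n else 0 := by
  split_ifs with h
  · subst h
    simp only [pmSign_mul_self, Finset.sum_const, Finset.card_univ, card_signs]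
    simp
  · let e : (Fin n → ({-1, 1} : Finset ℝ)) ≃ (Fin n → ({-1, 1} : Finset ℝ)) :=
      Equiv.piCongrRight (fun k => if k = i then signFlip else Equiv.refl _)
    have h1 := Equiv.sum_comp e (fun σ => (σ i : ℝ) * (σ j : ℝ))
    have h2 : ∀ σ, ((e σ i : ({-1, 1} : Finset ℝ)) : ℝ) * (e σ j : ({-1, 1} : Finset ℝ))
        = -((σ i : ℝ) * (σ j : ℝ)) := by
      intro σ
      have hj : ¬ j = i := fun h' => h h'.symm
      simp [e, hj, signFlip_coe]
    simp only [h2, Finset.sum_neg_distrib] at h1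
    linarith

lemma sum_norm_sq {E : Type*} [NormedAddCommGroup E] [InnerProductSpace ℝ E]
    (n : ℕ) (z : Fin n → E) :
    ∑ σ : Fin n → ({-1, 1} : Finset ℝ), ‖∑ i, (σ i : ℝ) • z i‖ ^ 2
      = 2 ^ n * ∑ i, ‖z i‖ ^ 2 := by
  have h : ∀ σ : Fin n → ({-1, 1} : Finset ℝ), ‖∑ i, (σ i : ℝ) • z i‖ ^ 2
      = ∑ i, ∑ j, ((σ i : ℝ) * (σ j : ℝ)) * ⟪z i, z j⟫ := by
    intro σ
    rw [← real_inner_self_eq_norm_sq, sum_inner]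
    refine Finset.sum_congr rfl fun i _ => ?_
    rw [inner_sum]
    refine Finset.sum_congr rfl fun j _ => ?_
    rw [real_inner_smul_left, real_inner_smul_right]
    ring
  simp only [h]
  rw [Finset.sum_comm, Finset.mul_sum]
  refine Finset.sum_congr rfl fun i _ => ?_
  rw [Finset.sum_comm]
  simp only [← Finset.sum_mul, sum_signs]
  simp

/-- Eq. (17) of Theorem 2: the empirical Rademacher complexity of the linear class
`{x ↦ ⟪w, x⟫ : ‖w‖ ≤ B}` on points `z i` with `‖z i‖ ≤ C` is at most `B C / √n`. -/
theorem rademacher_linear_class_bound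
    {E : Type*} [NormedAddCommGroup E] [InnerProductSpace ℝ E] [CompleteSpace E]
    (n : ℕ) (hn : 0 < n) (z : Fin n → E) (B C : ℝ) (hB : 0 ≤ B) (hC : 0 ≤ C)
    (hz : ∀ i, ‖z i‖ ≤ C) :
    (1 / 2 ^ n : ℝ) *
        ∑ σ : Fin n → ({-1, 1} : Finset ℝ),
          sSup {r : ℝ | ∃ w : E, ‖w‖ ≤ B ∧
            r = (1 / (n : ℝ)) * ∑ i, (σ i : ℝ) * ⟪w, z i⟫}
      ≤ B * C / Real.sqrt n := by
  have hn' : (0 : ℝ) < n := by exact_mod_cast hn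
  have hs : 0 < Real.sqrt n := Real.sqrt_pos.2 hn'
  have hss : Real.sqrt n * Real.sqrt n = n := Real.mul_self_sqrt hn'.le
  have h1 : ∀ σ : Fin n → ({-1, 1} : Finset ℝ),
      sSup {r : ℝ | ∃ w : E, ‖w‖ ≤ B ∧ r = (1 / (n : ℝ)) * ∑ i, (σ i : ℝ) * ⟪w, z i⟫}
        ≤ (B / n) * ‖∑ i, (σ i : ℝ) • z i‖ := by
    intro σ
    apply Real.sSup_le
    · rintro r ⟨w, hw, rfl⟩
      have : ∑ i, (σ i : ℝ) * ⟪w, z i⟫ = ⟪w, ∑ i, (σ i : ℝ) • z i⟫ := by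
        rw [inner_sum]
        exact Finset.sum_congr rfl fun i _ => (real_inner_smul_right _ _ _).symm
      rw [this]
      calc (1 / (n : ℝ)) * ⟪w, ∑ i, (σ i : ℝ) • z i⟫
          ≤ (1 / (n : ℝ)) * (B * ‖∑ i, (σ i : ℝ) • z i‖) := by
            gcongr
            exact (real_inner_le_norm _ _).trans (by gcongr)
        _ = _ := by ring
    · positivity
  have h2 : ∑ σ : Fin n → ({-1, 1} : Finset ℝ), ‖∑ i, (σ i : ℝ) • z i‖
      ≤ 2 ^ n * (Real.sqrt n * C) := by
    refine (abs_le_of_sq_le_sq' ?_ (by positivity)).2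
    have hcs := sq_sum_le_card_mul_sum_sq (s := (Finset.univ : Finset (Fin n → ({-1, 1} : Finset ℝ))))
      (f := fun σ => ‖∑ i, (σ i : ℝ) • z i‖)
    rw [sum_norm_sq, Finset.card_univ, card_signs] at hcs
    have hb : ∑ i, ‖z i‖ ^ 2 ≤ n * C ^ 2 := by
      calc ∑ i, ‖z i‖ ^ 2 ≤ ∑ i : Fin n, C ^ 2 :=
            Finset.sum_le_sum fun i _ => pow_le_pow_left₀ (norm_nonneg _) (hz i) 2
        _ = _ := by simp
    refine hcs.trans ?_
    push_cast
    calc (2 : ℝ) ^ n * (2 ^ n * ∑ i, ‖z i‖ ^ 2) ≤ 2 ^ n * (2 ^ n * (n * C ^ 2)) := by gcongr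
      _ = _ := by rw [mul_pow, mul_pow, Real.sq_sqrt hn'.le]; ring
  calc _ ≤ (1 / 2 ^ n : ℝ) * ∑ σ : Fin n → ({-1, 1} : Finset ℝ),
          (B / n) * ‖∑ i, (σ i : ℝ) • z i‖ := by
        gcongr with σ _
        exact h1 σ
    _ = (1 / 2 ^ n : ℝ) * (B / n * ∑ σ : Fin n → ({-1, 1} : Finset ℝ),
          ‖∑ i, (σ i : ℝ) • z i‖) := by rw [← Finset.mul_sum]
    _ ≤ (1 / 2 ^ n : ℝ) * (B / n * (2 ^ n * (Real.sqrt n * C))) := by gcongr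
    _ = B * C / Real.sqrt n := by
        rw [eq_div_iff hs.ne']
        have h3 : (2 : ℝ) ^ n ≠ 0 := by positivity
        calc (1 / 2 ^ n : ℝ) * (B / n * (2 ^ n * (Real.sqrt n * C))) * Real.sqrt n
            = ((1 / 2 ^ n : ℝ) * 2 ^ n) * (B * C) * ((Real.sqrt n * Real.sqrt n) / n) := by ring
          _ = B * C := by rw [hss, div_self hn'.ne', one_div_mul_cancel h3]; ring
end

section
/- Let n ∈ ℕ, let T be a nonempty set of vectors t : Fin n → ℝ that is bounded (there is M with |t i| ≤ M for all t ∈ T and all i), and for each i let φ i : ℝ → ℝ be 1-Lipschitz with φ i 0 = 0. Then the average over all sign vectors σ : Fin n → ({−1, 1} ⊆ ℝ) of sup_{t ∈ T} ∑_i σ i · φ i (t i) is at most the average over all sign vectors σ of sup_{t ∈ T} ∑_i σ i · t i. -/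
/-- Uniform boundedness of a real function. -/
def TalBdd {ι : Type} (f : ι → ℝ) : Prop := ∃ C : ℝ, ∀ t, |f t| ≤ C

theorem TalBdd.add {ι : Type} {f g : ι → ℝ} (hf : TalBdd f) (hg : TalBdd g) :
    TalBdd (fun t => f t + g t) := by
  obtain ⟨C, hC⟩ := hf
  obtain ⟨D, hD⟩ := hg
  exact ⟨C + D, fun t => (abs_add_le _ _).trans (add_le_add (hC t) (hD t))⟩

theorem TalBdd.smul {ι : Type} {f : ι → ℝ} (hf : TalBdd f) (a : ℝ) :
    TalBdd (fun t => a * f t) := by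
  obtain ⟨C, hC⟩ := hf
  refine ⟨|a| * C, fun t => ?_⟩
  rw [abs_mul]
  exact mul_le_mul_of_nonneg_left (hC t) (abs_nonneg a)

theorem TalBdd.sum {ι : Type} {n : ℕ} {f : ι → Fin n → ℝ}
    (hf : ∀ i, TalBdd (fun t => f t i)) (a : Fin n → ℝ) :
    TalBdd (fun t => ∑ i, a i * f t i) := by
  choose C hC using fun i => (hf i).smul (a i)
  exact ⟨∑ i, C i, fun t => (Finset.abs_sum_le_sum_abs _ _).trans
    (Finset.sum_le_sum fun i _ => hC i t)⟩

theorem TalBdd.bddAbove {ι : Type} {f : ι → ℝ} (hf : TalBdd f) :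
    BddAbove (Set.range f) := by
  obtain ⟨C, hC⟩ := hf
  refine ⟨C, ?_⟩
  rintro _ ⟨t, rfl⟩
  exact (le_abs_self _).trans (hC t)

theorem tal_one {ι : Type} [Nonempty ι] {H f g : ι → ℝ} (hH : TalBdd H) (hf : TalBdd f)
    (hfg : ∀ s t, |g s - g t| ≤ |f s - f t|) :
    ∑ a : ({-1, 1} : Finset ℝ), (⨆ t, (H t + (a : ℝ) * g t)) ≤
      ∑ a : ({-1, 1} : Finset ℝ), (⨆ t, (H t + (a : ℝ) * f t)) := by
  have key : ∀ k : ι → ℝ, ∑ a : ({-1, 1} : Finset ℝ), (⨆ t, (H t + (a : ℝ) * k t)) =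
      (⨆ t, (H t + (-1) * k t)) + (⨆ t, (H t + 1 * k t)) := by
    intro k
    rw [Finset.sum_coe_sort ({-1, 1} : Finset ℝ) (fun a => ⨆ t, (H t + a * k t)),
      Finset.sum_pair (by norm_num)]
  rw [key, key]
  have b1 := fun t => le_ciSup (hH.add (hf.smul (-1))).bddAbove t
  have b2 := fun t => le_ciSup (hH.add (hf.smul 1)).bddAbove t
  rw [← le_sub_iff_add_le]
  refine ciSup_le fun s => ?_
  rw [le_sub_comm]
  refine ciSup_le fun t => ?_
  have h1 := b1 s
  have h2 := b2 s
  have h3 := b1 t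
  have h4 := b2 t
  have h5 := (abs_le.mp (hfg s t)).1
  rcases abs_cases (f s - f t) with h | h <;> linarith

theorem tal_main {ι : Type} [Nonempty ι] (n : ℕ) : ∀ (h : ι → ℝ) (f g : ι → Fin n → ℝ),
    TalBdd h → (∀ i, TalBdd (fun t => f t i)) → (∀ i, TalBdd (fun t => g t i)) →
    (∀ i s t, |g s i - g t i| ≤ |f s i - f t i|) →
    ∑ σ : Fin n → ({-1, 1} : Finset ℝ), (⨆ t, (h t + ∑ i, (σ i : ℝ) * g t i)) ≤
      ∑ σ : Fin n → ({-1, 1} : Finset ℝ), (⨆ t, (h t + ∑ i, (σ i : ℝ) * f t i)) := by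
  induction n with
  | zero => intro h f g _ _ _ _; simp
  | succ n ih =>
    intro h f g hh hf hg hfg
    have split : ∀ k : ι → Fin (n + 1) → ℝ,
        ∑ σ : Fin (n + 1) → ({-1, 1} : Finset ℝ), (⨆ t, (h t + ∑ i, (σ i : ℝ) * k t i)) =
        ∑ a : ({-1, 1} : Finset ℝ), ∑ σ : Fin n → ({-1, 1} : Finset ℝ),
          (⨆ t, (h t + (a : ℝ) * k t 0 + ∑ i, (σ i : ℝ) * k t i.succ)) := by
      intro k
      rw [← Fintype.sum_prod_type',
        ← (Fin.consEquiv (fun _ : Fin (n + 1) => ({-1, 1} : Finset ℝ))).sum_comp]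
      refine Finset.sum_congr rfl fun p _ => ?_
      simp [Fin.consEquiv, Fin.sum_univ_succ, add_assoc]
    rw [split, split]
    calc _ ≤ ∑ a : ({-1, 1} : Finset ℝ), ∑ σ : Fin n → ({-1, 1} : Finset ℝ),
          (⨆ t, (h t + (a : ℝ) * g t 0 + ∑ i, (σ i : ℝ) * f t i.succ)) :=
        Finset.sum_le_sum fun a _ => ih _ (fun t i => f t i.succ) (fun t i => g t i.succ)
          (hh.add ((hg 0).smul a)) (fun i => hf i.succ) (fun i => hg i.succ)
          (fun i => hfg i.succ)
      _ ≤ _ := by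
        rw [Finset.sum_comm]
        conv_rhs => rw [Finset.sum_comm]
        refine Finset.sum_le_sum fun σ _ => ?_
        have := tal_one (hh.add (TalBdd.sum (fun i : Fin n => hf i.succ) (fun i => (σ i : ℝ))))
          (hf 0) (hfg 0)
        simpa only [add_right_comm] using this

/-- Talagrand's contraction lemma for Rademacher averages: composing with
coordinatewise 1-Lipschitz maps `φ i` (with `φ i 0 = 0`) does not increase the
Rademacher average. -/
theorem talagrand_contraction
    (n : ℕ) (T : Set (Fin n → ℝ)) (hT : T.Nonempty)
    (hbdd : ∃ M : ℝ, ∀ t ∈ T, ∀ i, |t i| ≤ M)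
    (φ : Fin n → ℝ → ℝ) (hlip : ∀ i, LipschitzWith 1 (φ i))
    (hzero : ∀ i, φ i 0 = 0) :
    (1 / 2 ^ n : ℝ) *
        ∑ σ : Fin n → ({-1, 1} : Finset ℝ),
          sSup {r : ℝ | ∃ t ∈ T, r = ∑ i, (σ i : ℝ) * φ i (t i)}
      ≤ (1 / 2 ^ n : ℝ) *
        ∑ σ : Fin n → ({-1, 1} : Finset ℝ),
          sSup {r : ℝ | ∃ t ∈ T, r = ∑ i, (σ i : ℝ) * t i} := by
  refine mul_le_mul_of_nonneg_left ?_ (by positivity)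
  have conv : ∀ k : (Fin n → ℝ) → ℝ,
      sSup {r : ℝ | ∃ t ∈ T, r = k t} = ⨆ t : T, (0 + k t) := by
    intro k
    rw [iSup]
    congr 1
    ext r
    simp [eq_comm]
  have hl : ∀ i x y, |φ i x - φ i y| ≤ |x - y| := by
    intro i x y
    have := (hlip i).dist_le_mul x y
    simpa [Real.dist_eq] using this
  obtain ⟨M, hM⟩ := hbdd
  haveI : Nonempty T := hT.to_subtype
  have := tal_main (ι := T) n (fun _ => 0) (fun t i => t.1 i) (fun t i => φ i (t.1 i))
    ⟨0, by simp⟩ (fun i => ⟨M, fun t => hM t.1 t.2 i⟩)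
    (fun i => ⟨M, fun t => by
      have h := hl i (t.1 i) 0
      rw [hzero, sub_zero, sub_zero] at h
      exact h.trans (hM t.1 t.2 i)⟩)
    (fun i s t => hl i _ _)
  have e1 := fun σ : Fin n → ({-1, 1} : Finset ℝ) => conv (fun t => ∑ i, (σ i : ℝ) * φ i (t i))
  have e2 := fun σ : Fin n → ({-1, 1} : Finset ℝ) => conv (fun t => ∑ i, (σ i : ℝ) * t i)
  rw [Finset.sum_congr rfl fun σ _ => e1 σ, Finset.sum_congr rfl fun σ _ => e2 σ]
  exact this
end

section
/- Let P, Q be Borel probability measures on ℝ with cumulative distribution functions cdf P x = P(Iic x) and cdf Q x = Q(Iic x). If the Lebesgue integral ∫⁻ x, ENNReal.ofReal |cdf P x − cdf Q x| dx (with respect to Lebesgue measure on ℝ) equals 0, then P = Q. -/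
open MeasureTheory

/-- Cumulative distribution function of a Borel measure on `ℝ`. -/
noncomputable def cdf (P : Measure ℝ) (x : ℝ) : ℝ := (P (Set.Iic x)).toReal

/-- Discriminative power of the Wasserstein-1 component (Proposition 1, item 5):
if `∫ |cdf P − cdf Q| dx = 0` (i.e. `W₁(P,Q) = 0`) then `P = Q`. -/
theorem wasserstein_zero_implies_eq
    (P Q : Measure ℝ) [IsProbabilityMeasure P] [IsProbabilityMeasure Q]
    (h : ∫⁻ x : ℝ, ENNReal.ofReal |cdf P x - cdf Q x| = 0) :
    P = Q := by
  have hc : ∀ (R : Measure ℝ) [IsProbabilityMeasure R] (x : ℝ),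
      cdf R x = ProbabilityTheory.cdf R x := fun R _ x => by
    rw [ProbabilityTheory.cdf_eq_real]; rfl
  simp only [hc] at h
  have hmeas : Measurable fun x : ℝ =>
      ENNReal.ofReal |ProbabilityTheory.cdf P x - ProbabilityTheory.cdf Q x| := by
    have h1 := (ProbabilityTheory.monotone_cdf P).measurable
    have h2 := (ProbabilityTheory.monotone_cdf Q).measurable
    have h3 := (continuous_abs.measurable).comp (h1.sub h2)
    exact h3.ennreal_ofReal
  have hae := (lintegral_eq_zero_iff hmeas).1 h
  have hD := Measure.dense_of_ae hae
  apply Measure.eq_of_cdf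
  ext a
  have hP := ((ProbabilityTheory.cdf P).right_continuous a).mono Set.Ioi_subset_Ici_self
  have hQ := ((ProbabilityTheory.cdf Q).right_continuous a).mono Set.Ioi_subset_Ici_self
  refine tendsto_nhds_unique_of_frequently_eq hP hQ ?_
  intro hev
  obtain ⟨b, hb, hsub⟩ := mem_nhdsGT_iff_exists_Ioo_subset.1 hev
  obtain ⟨x, hx, hx1, hx2⟩ := hD.exists_between hb
  refine hsub ⟨hx1, hx2⟩ ?_
  have h0 : |ProbabilityTheory.cdf P x - ProbabilityTheory.cdf Q x| ≤ 0 :=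
    ENNReal.ofReal_eq_zero.1 hx
  exact sub_eq_zero.1 (abs_nonpos_iff.1 h0)
end

section
/- Let E be a real inner product space, f : E → ℝ, x* ∈ E, and 0 < μ ≤ L. Assume the two-sided quadratic sandwich (μ/2)·‖x − x*‖² ≤ f x − f x* ≤ (L/2)·‖x − x*‖² for all x ∈ E, and f x* ≥ 0. Let g ∈ (0, 1) and let φ_ckpt, φ_curr ∈ E satisfy f φ_ckpt < g · f φ_curr. Then ‖φ_ckpt − x*‖² ≤ g · (L/μ) · ‖φ_curr − x*‖². -/
/-- Proposition 2 (sufficient condition for beneficial checkpoint loading): under the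
quadratic sandwich `(μ/2)‖x−x*‖² ≤ f x − f x* ≤ (L/2)‖x−x*‖²` with `f x* ≥ 0`, the
loss gate `f(ckpt) < g · f(curr)` implies
`‖ckpt − x*‖² ≤ g (L/μ) ‖curr − x*‖²`. -/
theorem loss_gate_implies_closer
    {E : Type*} [NormedAddCommGroup E] [InnerProductSpace ℝ E]
    (f : E → ℝ) (xstar : E) (μ L : ℝ) (hμ : 0 < μ) (hμL : μ ≤ L)
    (hlow : ∀ x, (μ / 2) * ‖x - xstar‖ ^ 2 ≤ f x - f xstar)
    (hupp : ∀ x, f x - f xstar ≤ (L / 2) * ‖x - xstar‖ ^ 2)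
    (hfstar : 0 ≤ f xstar)
    (g : ℝ) (hg0 : 0 < g) (hg1 : g < 1)
    (φckpt φcurr : E) (hgate : f φckpt < g * f φcurr) :
    ‖φckpt - xstar‖ ^ 2 ≤ g * (L / μ) * ‖φcurr - xstar‖ ^ 2 := by
  have h1 := hlow φckpt
  have h2 := mul_le_mul_of_nonneg_left (hupp φcurr) hg0.le
  have h3 : 0 ≤ (1 - g) * f xstar := mul_nonneg (by linarith) hfstar
  have h4 : g * (L / μ) * ‖φcurr - xstar‖ ^ 2 = (g * L * ‖φcurr - xstar‖ ^ 2) / μ := by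
    ring
  rw [h4, le_div_iff₀ hμ]
  linarith
end
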